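/- There exists a constant c > 0, depending only on C0 and C1, such that for every ε ∈ [0,1], every (C0,C1)-elliptic symmetric matrix γ and all ξ, ξ̃ ∈ ℝ^{nN} with |ξ|_γ > 1 one has ⟨A_ε(γ,ξ̃) − A_ε(γ,ξ), ξ̃ − ξ⟩_γ ≥ c [ε + (min{1, p−1}/2^{p+1}) · (|ξ|_γ − 1)^p / (|ξ|_γ (|ξ|_γ + |ξ̃|_γ))] |ξ̃ − ξ|². -/

import Mathlib

noncomputable section

open Real

/-- The `γ`-inner product on `ℝ^{nN}`. -/
def gInner {n N : ℕ} (γ : Matrix (Fin n) (Fin n) ℝ) (ξ η : Fin N → Fin n → ℝ) : ℝ :=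
  ∑ i, ∑ α, ∑ β, γ α β * ξ i α * η i β

/-- The `γ`-norm on `ℝ^{nN}`. -/
def gNorm {n N : ℕ} (γ : Matrix (Fin n) (Fin n) ℝ) (ξ : Fin N → Fin n → ℝ) : ℝ :=
  Real.sqrt (gInner γ ξ ξ)

/-- The Euclidean norm on `ℝ^{nN}`. -/
def eNorm {n N : ℕ} (ξ : Fin N → Fin n → ℝ) : ℝ :=
  Real.sqrt (∑ i, ∑ α, ξ i α ^ 2)

/-- A symmetric `(C0, C1)`-elliptic matrix. -/
def IsElliptic {n : ℕ} (C0 C1 : ℝ) (γ : Matrix (Fin n) (Fin n) ℝ) : Prop :=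
  (∀ α β, γ α β = γ β α) ∧
  ∀ ζ : Fin n → ℝ,
    C0 * ∑ α, ζ α ^ 2 ≤ (∑ α, ∑ β, γ α β * ζ α * ζ β) ∧
    (∑ α, ∑ β, γ α β * ζ α * ζ β) ≤ C1 * ∑ α, ζ α ^ 2

/-- `h(t) = (t-1)_+^{p-1} / t` (with the convention `h(0) = 0`). -/
def hfun (p t : ℝ) : ℝ := (max (t - 1) 0) ^ (p - 1) / t

/-- `g(t) = (t-1)_+^p / t`. -/
def gfun (p t : ℝ) : ℝ := (max (t - 1) 0) ^ p / t

/-- The derivative of `h` on `(1,∞)`, extended by `0` elsewhere. -/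
def hderiv (p s : ℝ) : ℝ :=
  if 1 < s then (s - 1) ^ (p - 2) * ((p - 2) * s + 1) / s ^ 2 else 0

/-- The derivative of `g` on `(1,∞)`, extended by `0` elsewhere. -/
def gderiv (p s : ℝ) : ℝ :=
  if 1 < s then (s - 1) ^ (p - 1) * ((p - 1) * s + 1) / s ^ 2 else 0

/-- `λ(t) = min{h(t), (p-1)(t-1)^{p-2}}` for `t > 1`, and `0` for `t ≤ 1`. -/
def lamFun (p t : ℝ) : ℝ :=
  if 1 < t then min (hfun p t) ((p - 1) * (t - 1) ^ (p - 2)) else 0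

/-- `Λ(t) = max{h(t), (p-1)(t-1)^{p-2}}` for `t > 1`, and `0` for `t ≤ 1`. -/
def LamFun (p t : ℝ) : ℝ :=
  if 1 < t then max (hfun p t) ((p - 1) * (t - 1) ^ (p - 2)) else 0

/-- The vector field `A_ε(γ, ξ) = h_ε(|ξ|_γ) ξ` (equal to `0` at `ξ = 0`). -/
def Avf {n N : ℕ} (p ε : ℝ) (γ : Matrix (Fin n) (Fin n) ℝ) (ξ : Fin N → Fin n → ℝ) :
    Fin N → Fin n → ℝ :=
  fun i α => (hfun p (gNorm γ ξ) + ε) * ξ i α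

/-- The map `G_δ(γ, ξ) = ((|ξ|_γ - 1 - δ)_+ / |ξ|_γ) ξ` (equal to `0` at `ξ = 0`). -/
def Gmap {n N : ℕ} (δ : ℝ) (γ : Matrix (Fin n) (Fin n) ℝ) (ξ : Fin N → Fin n → ℝ) :
    Fin N → Fin n → ℝ :=
  fun i α => (max (gNorm γ ξ - 1 - δ) 0) / gNorm γ ξ * ξ i α

/-- The bilinear form `𝒜_ε(γ, ξ)` on third-order tensors in `ℝ^{n²N}`. -/
def Aform {n N : ℕ} (p ε : ℝ) (γ : Matrix (Fin n) (Fin n) ℝ) (ξ : Fin N → Fin n → ℝ)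
    (η ζ : Fin N → Fin n → Fin n → ℝ) : ℝ :=
  ∑ i, ∑ j, ∑ α, ∑ β, ∑ ν, ∑ σ,
    ((hfun p (gNorm γ ξ) + ε) * γ α β * (if i = j then (1 : ℝ) else 0) +
        hderiv p (gNorm γ ξ) / gNorm γ ξ *
          (∑ d, γ α d * ξ i d) * (∑ k, γ β k * ξ j k)) *
      γ ν σ * η i α ν * ζ j β σ

/-- The bilinear form `ℬ_ε(γ, ξ)` on `ℝ^{nN}`. -/
def Bform {n N : ℕ} (p ε : ℝ) (γ : Matrix (Fin n) (Fin n) ℝ) (ξ : Fin N → Fin n → ℝ)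
    (η ζ : Fin N → Fin n → ℝ) : ℝ :=
  ∑ i, ∑ j, ∑ α, ∑ β,
    ((hfun p (gNorm γ ξ) + ε) * γ α β * (if i = j then (1 : ℝ) else 0) +
        hderiv p (gNorm γ ξ) / gNorm γ ξ *
          (∑ d, γ α d * ξ i d) * (∑ k, γ β k * ξ j k)) *
      η i α * ζ j β

/-- The bilinear form `𝒞_ε(γ, ξ)` on `ℝ^n`. -/
def Cform {n N : ℕ} (p ε : ℝ) (γ : Matrix (Fin n) (Fin n) ℝ) (ξ : Fin N → Fin n → ℝ)
    (ζ ζ' : Fin n → ℝ) : ℝ :=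
  ∑ α, ∑ β,
    ((hfun p (gNorm γ ξ) + ε) * γ α β +
        hderiv p (gNorm γ ξ) / gNorm γ ξ *
          (∑ i, (∑ d, γ α d * ξ i d) * (∑ k, γ β k * ξ i k))) *
      ζ α * ζ' β

/-- The squared `γ`-norm of a third-order tensor in `ℝ^{n²N}`. -/
def tNormSq {n N : ℕ} (γ : Matrix (Fin n) (Fin n) ℝ) (η : Fin N → Fin n → Fin n → ℝ) : ℝ :=
  ∑ i, ∑ α, ∑ β, ∑ ν, ∑ σ, γ α β * γ ν σ * η i α ν * η i β σ

theorem gInner_sub_smul {n N : ℕ} (γ : Matrix (Fin n) (Fin n) ℝ) (ξ η : Fin N → Fin n → ℝ)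
    (a b c d : ℝ) :
    gInner γ (fun i α => a * ξ i α - b * η i α) (fun i α => c * ξ i α - d * η i α) =
      a * c * gInner γ ξ ξ - a * d * gInner γ ξ η - b * c * gInner γ η ξ +
        b * d * gInner γ η η := by
  simp only [gInner, Finset.mul_sum, ← Finset.sum_add_distrib, ← Finset.sum_sub_distrib]
  refine Finset.sum_congr rfl fun i _ => Finset.sum_congr rfl fun α _ =>
    Finset.sum_congr rfl fun β _ => ?_
  ring

theorem IsElliptic.gInner_comm {n N : ℕ} {C0 C1 : ℝ} {γ : Matrix (Fin n) (Fin n) ℝ}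
    (hγ : IsElliptic C0 C1 γ) (ξ η : Fin N → Fin n → ℝ) : gInner γ ξ η = gInner γ η ξ := by
  refine Finset.sum_congr rfl fun i _ => ?_
  rw [Finset.sum_comm]
  refine Finset.sum_congr rfl fun α _ => Finset.sum_congr rfl fun β _ => ?_
  rw [hγ.1 β α]
  ring

theorem IsElliptic.mul_eNorm_sq_le {n N : ℕ} {C0 C1 : ℝ} {γ : Matrix (Fin n) (Fin n) ℝ}
    (hγ : IsElliptic C0 C1 γ) (ξ : Fin N → Fin n → ℝ) : C0 * eNorm ξ ^ 2 ≤ gInner γ ξ ξ := by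
  rw [eNorm, Real.sq_sqrt (by positivity), Finset.mul_sum]
  exact Finset.sum_le_sum fun i _ => (hγ.2 (ξ i)).1

theorem IsElliptic.gInner_self_nonneg {n N : ℕ} {C0 C1 : ℝ} {γ : Matrix (Fin n) (Fin n) ℝ}
    (hγ : IsElliptic C0 C1 γ) (hC0 : 0 < C0) (ξ : Fin N → Fin n → ℝ) : 0 ≤ gInner γ ξ ξ :=
  (by positivity : 0 ≤ C0 * eNorm ξ ^ 2).trans (hγ.mul_eNorm_sq_le ξ)

theorem IsElliptic.sq_gNorm {n N : ℕ} {C0 C1 : ℝ} {γ : Matrix (Fin n) (Fin n) ℝ}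
    (hγ : IsElliptic C0 C1 γ) (hC0 : 0 < C0) (ξ : Fin N → Fin n → ℝ) :
    gNorm γ ξ ^ 2 = gInner γ ξ ξ :=
  Real.sq_sqrt (hγ.gInner_self_nonneg hC0 ξ)

/-- Cauchy–Schwarz for the `γ`-inner product. -/
theorem IsElliptic.abs_gInner_le {n N : ℕ} {C0 C1 : ℝ} {γ : Matrix (Fin n) (Fin n) ℝ}
    (hγ : IsElliptic C0 C1 γ) (hC0 : 0 < C0) (ξ η : Fin N → Fin n → ℝ) :
    |gInner γ ξ η| ≤ gNorm γ ξ * gNorm γ η := by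
  have hd : discrim (gInner γ ξ ξ) (-2 * gInner γ ξ η) (gInner γ η η) ≤ 0 := by
    refine discrim_le_zero fun t => ?_
    have h := hγ.gInner_self_nonneg hC0 (fun i α => t * ξ i α - 1 * η i α)
    rw [gInner_sub_smul, hγ.gInner_comm η ξ] at h
    linarith
  refine abs_le_of_sq_le_sq ?_ (mul_nonneg (Real.sqrt_nonneg _) (Real.sqrt_nonneg _))
  rw [mul_pow, hγ.sq_gNorm hC0, hγ.sq_gNorm hC0]
  rw [discrim] at hd
  linarith

theorem min_one_mul_one_sub_le_one_sub_rpow {q t : ℝ} (hq : 0 < q) (ht0 : 0 ≤ t) (ht1 : t ≤ 1) :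
    min 1 q * (1 - t) ≤ 1 - t ^ q := by
  rcases le_total 1 q with h | h
  · rw [min_eq_left h]
    have := Real.rpow_le_rpow_of_exponent_ge' ht0 ht1 zero_le_one h
    rw [Real.rpow_one] at this
    linarith
  · rw [min_eq_right h]
    have := rpow_one_add_le_one_add_mul_self (s := t - 1) (by linarith) hq.le h
    rw [add_sub_cancel] at this
    linarith

theorem min_one_mul_rpow_div_mul_sub_le {q u v : ℝ} (hq : 0 < q) (hv : 0 ≤ v) (huv : v ≤ u)
    (hu : 0 < u) : min 1 q * (u ^ q / u) * (u - v) ≤ u ^ q - v ^ q := by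
  have h := min_one_mul_one_sub_le_one_sub_rpow hq (div_nonneg hv hu.le) ((div_le_one hu).2 huv)
  rw [Real.div_rpow hv hu.le] at h
  have hp := Real.rpow_pos_of_pos hu q
  calc min 1 q * (u ^ q / u) * (u - v) = u ^ q * (min 1 q * (1 - v / u)) := by field_simp
    _ ≤ u ^ q * (1 - v ^ q / u ^ q) := by gcongr
    _ = u ^ q - v ^ q := by field_simp

/-- Strong monotonicity of `t ↦ (t - 1)_+ ^ q` at points beyond `1`. -/
theorem mul_sub_sq_le_posPart_rpow_sub_mul_sub {q a b : ℝ} (hq : 0 < q) (ha : 1 < a)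
    (hb : 0 ≤ b) :
    min 1 q * ((a - 1) ^ q / (a + b)) * (a - b) ^ 2 ≤
      ((a - 1) ^ q - max (b - 1) 0 ^ q) * (a - b) := by
  have hm0 : 0 < min 1 q := lt_min one_pos hq
  have hx : 0 < (a - 1) ^ q := Real.rpow_pos_of_pos (by linarith) q
  have key : ∀ u v : ℝ, a - 1 ≤ u → u ≤ a + b → 0 ≤ v → v ≤ u →
      min 1 q * ((a - 1) ^ q / (a + b)) * (u - v) ≤ u ^ q - v ^ q := by
    intro u v hau hub hv hvu
    have hu : 0 < u := by linarith
    have hvu' : 0 ≤ u - v := by linarith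
    refine le_trans ?_ (min_one_mul_rpow_div_mul_sub_le hq hv hvu hu)
    have : 0 ≤ a - 1 := by linarith
    gcongr
  rcases le_total b 1 with h1 | h1
  · rw [max_eq_right (by linarith), Real.zero_rpow hq.ne', sub_zero]
    have h : min 1 q * ((a - 1) ^ q / (a + b)) * (a - b) ≤ (a - 1) ^ q := by
      calc min 1 q * ((a - 1) ^ q / (a + b)) * (a - b)
          ≤ 1 * ((a - 1) ^ q / (a + b)) * (a + b) := by
            have : 0 ≤ a - b := by linarith
            gcongr
            · exact min_le_left _ _
            · linarith
        _ = (a - 1) ^ q := by field_simp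
    nlinarith
  · rw [max_eq_left (by linarith)]
    rcases le_total b a with h2 | h2
    · nlinarith [key (a - 1) (b - 1) le_rfl (by linarith) (by linarith) (by linarith)]
    · nlinarith [key (b - 1) (a - 1) (by linarith) (by linarith) (by linarith) (by linarith)]

theorem hfun_mul_self {p : ℝ} (hp : 1 < p) (t : ℝ) :
    hfun p t * t = max (t - 1) 0 ^ (p - 1) := by
  rcases eq_or_ne t 0 with rfl | ht
  · simp [Real.zero_rpow (sub_pos.2 hp).ne']
  · exact div_mul_cancel₀ _ ht

/-- The monotonicity estimate, in terms of `a = |ξ|_γ`, `b = |ξ'|_γ` and `s = ⟨ξ', ξ⟩_γ`. -/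
theorem mul_sq_dist_le_hfun {p a b s : ℝ} (hp : 1 < p) (ha : 1 < a) (hb : 0 ≤ b)
    (hs : |s| ≤ a * b) :
    min 1 (p - 1) / (2 : ℝ) ^ (p + 1) * ((a - 1) ^ p / (a * (a + b))) *
        (a ^ 2 + b ^ 2 - 2 * s) ≤
      hfun p b * b ^ 2 + hfun p a * a ^ 2 - (hfun p a + hfun p b) * s := by
  have hq : 0 < p - 1 := sub_pos.2 hp
  have hm0 : 0 < min 1 (p - 1) := lt_min one_pos hq
  have ha1 : 0 < a - 1 := by linarith
  have hx : 0 < (a - 1) ^ (p - 1) := Real.rpow_pos_of_pos ha1 _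
  set L := min 1 (p - 1) * ((a - 1) ^ (p - 1) / (a + b)) with hL
  set K := min 1 (p - 1) / (2 : ℝ) ^ (p + 1) * ((a - 1) ^ p / (a * (a + b))) with hK
  have hKL : K ≤ L := by
    have h2 : (1 : ℝ) ≤ 2 ^ (p + 1) := Real.one_le_rpow (by norm_num) (by linarith)
    have hpow : (a - 1) ^ p = (a - 1) ^ (p - 1) * (a - 1) := by
      rw [← Real.rpow_add_one ha1.ne', sub_add_cancel]
    rw [hK, hL]
    refine mul_le_mul (div_le_self hm0.le h2) ?_ (by positivity) hm0.le
    rw [hpow, mul_comm a, ← div_div, div_le_iff₀ (by linarith), div_mul_eq_mul_div]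
    gcongr
    linarith
  have hfa := hfun_mul_self hp a
  have hfb := hfun_mul_self hp b
  rw [max_eq_left ha1.le] at hfa
  have hfb0 : 0 ≤ hfun p b * b := hfb ▸ by positivity
  have hpar := mul_sub_sq_le_posPart_rpow_sub_mul_sub hq ha hb
  rw [← hL, ← hfa, ← hfb] at hpar
  have hanti : L * (a + b) ≤ hfun p a * a := by
    rw [hL, hfa, mul_assoc, div_mul_cancel₀ _ (by linarith)]
    nlinarith [min_le_left 1 (p - 1)]
  have h1 : K * (a - b) ^ 2 ≤ (hfun p a * a - hfun p b * b) * (a - b) := by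
    nlinarith [sq_nonneg (a - b)]
  have h2 : K * (a + b) ^ 2 ≤ (hfun p a * a + hfun p b * b) * (a + b) := by
    have hab : 0 < a + b := by linarith
    have : K * (a + b) ≤ hfun p a * a + hfun p b * b := by nlinarith
    nlinarith
  obtain ⟨hs1, hs2⟩ := abs_le.1 hs
  -- The claim is affine in `s`, so it follows from the cases `s = a * b` and `s = -(a * b)`.
  rcases le_total 0 (hfun p a + hfun p b - 2 * K) with h | h
  · nlinarith [mul_le_mul_of_nonneg_left hs2 h]
  · nlinarith [mul_le_mul_of_nonpos_left hs1 h]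

/-- part 2) of Lemma `monotonicity`. -/
theorem statement12 (C0 C1 : ℝ) (hC0 : 0 < C0) (hC01 : C0 ≤ C1) :
    ∃ c : ℝ, 0 < c ∧
      ∀ (n N : ℕ), 1 ≤ n → 1 ≤ N →
        ∀ p : ℝ, 1 < p →
          ∀ ε : ℝ, 0 ≤ ε → ε ≤ 1 →
            ∀ γ : Matrix (Fin n) (Fin n) ℝ, IsElliptic C0 C1 γ →
              ∀ ξ ξ' : Fin N → Fin n → ℝ, 1 < gNorm γ ξ →
                c * (ε + min 1 (p - 1) / (2 : ℝ) ^ (p + 1) *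
                      ((gNorm γ ξ - 1) ^ p /
                        (gNorm γ ξ * (gNorm γ ξ + gNorm γ ξ')))) *
                    eNorm (fun i α => ξ' i α - ξ i α) ^ 2 ≤
                  gInner γ (fun i α => Avf p ε γ ξ' i α - Avf p ε γ ξ i α)
                    (fun i α => ξ' i α - ξ i α) := by
  refine ⟨C0, hC0, fun n N _ _ p hp ε hε _ γ hγ ξ ξ' hξ => ?_⟩
  have hb : 0 ≤ gNorm γ ξ' := Real.sqrt_nonneg _
  have hE := hγ.mul_eNorm_sq_le (fun i α => ξ' i α - ξ i α)
  have hD := gInner_sub_smul γ ξ' ξ 1 1 1 1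
  have hA := gInner_sub_smul γ ξ' ξ (hfun p (gNorm γ ξ') + ε) (hfun p (gNorm γ ξ) + ε) 1 1
  simp only [one_mul, mul_one] at hD hA
  have hmain := mul_sq_dist_le_hfun hp hξ hb (hγ.abs_gInner_le hC0 ξ ξ')
  have hK : 0 ≤ min 1 (p - 1) / (2 : ℝ) ^ (p + 1) *
      ((gNorm γ ξ - 1) ^ p / (gNorm γ ξ * (gNorm γ ξ + gNorm γ ξ'))) := by
    have : 0 ≤ min 1 (p - 1) := le_min zero_le_one (by linarith)
    have : 0 ≤ gNorm γ ξ - 1 := by linarith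
    positivity
  simp only [Avf]
  rw [hA, hγ.gInner_comm ξ' ξ]
  rw [hγ.gInner_comm ξ' ξ] at hD
  rw [hD] at hE
  rw [hγ.sq_gNorm hC0, hγ.sq_gNorm hC0] at hmain
  linarith [mul_le_mul_of_nonneg_left hE (add_nonneg hε hK)]
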